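/- arXiv:math/0209268 — 3 statements merged into one kernel-verified Lean document; each statement's English description precedes it below -/
import Mathlib

section
/- Let q be a real number with 0 < q < 1 and let O(ℝP²_q) be the coordinate *-algebra of the quantum real projective plane (presented by generators P, R, R′, T, T′ and the relations listed in the context). Let H = ℓ²(ℕ) with standard orthonormal basis (e_k)_{k∈ℕ} and let ρP, ρT, ρR be the bounded operators with ρP e_k = q^{4k} e_k, ρT e_k = q^{2(k−1)}√(1−q^{4k}) e_{k−1}, ρR e_k = √((1−q^{4k})(1−q^{4(k−1)})) e_{k−2}. Then the unital ℂ-algebra homomorphism ρ : O(ℝP²_q) → B(H) determined by P ↦ ρP, R ↦ ρR, T ↦ ρT, R′ ↦ ρR*, T′ ↦ ρT* is injective; that is, the infinite-dimensional irreducible representation ρ is faithful. -/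
namespace RP2

/-- Generator `P` of `O(ℝP²_q)` in the free algebra on five generators. -/
noncomputable def P : FreeAlgebra ℂ (Fin 5) := FreeAlgebra.ι ℂ 0
/-- Generator `R` of `O(ℝP²_q)`. -/
noncomputable def R : FreeAlgebra ℂ (Fin 5) := FreeAlgebra.ι ℂ 1
/-- Generator `R′ = R*` of `O(ℝP²_q)`. -/
noncomputable def R' : FreeAlgebra ℂ (Fin 5) := FreeAlgebra.ι ℂ 2
/-- Generator `T` of `O(ℝP²_q)`. -/
noncomputable def T : FreeAlgebra ℂ (Fin 5) := FreeAlgebra.ι ℂ 3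
/-- Generator `T′ = T*` of `O(ℝP²_q)`. -/
noncomputable def T' : FreeAlgebra ℂ (Fin 5) := FreeAlgebra.ι ℂ 4

/-- The defining relations of the coordinate `*`-algebra `O(ℝP²_q)` of the quantum real
projective plane, on generators `P, R, R′, T, T′` (with `R′, T′` playing the roles of
`R*, T*`), together with their images under the involution. -/
inductive Rel (q : ℝ) : FreeAlgebra ℂ (Fin 5) → FreeAlgebra ℂ (Fin 5) → Prop
  | rel1  : Rel q (R * P) (((q : ℂ) ^ 8) • (P * R))
  | rel2  : Rel q (R * T) (((q : ℂ) ^ 4) • (T * R))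
  | rel3  : Rel q (P * T) ((((q : ℂ) ^ 4)⁻¹) • (T * P))
  | rel4  : Rel q (T * T) (((q : ℂ) ^ 2) • (P * R))
  | rel5  : Rel q (R * T') (((q : ℂ) ^ 2) • (T * (1 - ((q : ℂ) ^ 4) • P)))
  | rel6  : Rel q (R' * T) ((((q : ℂ) ^ 2)⁻¹) • (T' * (1 - P)))
  | rel7  : Rel q (R * R')
      (((q : ℂ) ^ 12) • (P * P) - ((q : ℂ) ^ 4 * (1 + (q : ℂ) ^ 4)) • P + 1)
  | rel8  : Rel q (R' * R)
      ((((q : ℂ) ^ 4)⁻¹) • (P * P) - (1 + ((q : ℂ) ^ 4)⁻¹) • P + 1)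
  | rel9  : Rel q (T * T') (P - ((q : ℂ) ^ 4) • (P * P))
  | rel10 : Rel q (T' * T) ((((q : ℂ) ^ 4)⁻¹) • (P - P * P))
  | rel11 : Rel q (P * R') (((q : ℂ) ^ 8) • (R' * P))
  | rel12 : Rel q (T' * R') (((q : ℂ) ^ 4) • (R' * T'))
  | rel13 : Rel q (T' * P) ((((q : ℂ) ^ 4)⁻¹) • (P * T'))
  | rel14 : Rel q (T' * T') (((q : ℂ) ^ 2) • (R' * P))
  | rel15 : Rel q (T * R') (((q : ℂ) ^ 2) • ((1 - ((q : ℂ) ^ 4) • P) * T'))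
  | rel16 : Rel q (T' * R) ((((q : ℂ) ^ 2)⁻¹) • ((1 - P) * T))

end RP2

namespace RP2

open Polynomial

section Spanning

variable {A : Type*} [Ring A]

/-- The monomial `r ^ (n / 2) * t ^ (n % 2)`, a homogeneous element of degree `n`. -/
def mono (r t : A) : ℕ → A
  | 0 => 1
  | 1 => t
  | n + 2 => r * mono r t n

/-- The homogeneous monomials indexed by their degree in `ℤ`. -/
def intMono (r t r' t' : A) (n : ℤ) : A :=
  if 0 ≤ n then mono r t n.toNat else mono r' t' (-n).toNat

lemma intMono_natCast (r t r' t' : A) (n : ℕ) : intMono r t r' t' n = mono r t n := by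
  simp [intMono]

lemma intMono_neg_natCast (r t r' t' : A) (n : ℕ) : intMono r t r' t' (-n) = mono r' t' n := by
  rcases n.eq_zero_or_pos with rfl | hn
  · simp [intMono, mono]
  · rw [intMono, if_neg (by omega)]
    simp

variable [Algebra ℂ A]

/-- The shape of the relations of `O(ℝP²_q)` for moving `r` and `t` to the right,
with the coefficients left unspecified. -/
structure HalfRel (p r t r' t' : A) : Prop where
  r_p : ∃ c : ℂ, r * p = c • (p * r)
  t_p : ∃ c : ℂ, t * p = c • (p * t)
  t_r : ∃ c : ℂ, t * r = c • (r * t)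
  t_t : ∃ c : ℂ, t * t = c • (p * r)
  r_r' : ∃ f : ℂ[X], r * r' = aeval p f
  r_t' : ∃ f : ℂ[X], r * t' = aeval p f * t
  t_r' : ∃ f : ℂ[X], t * r' = aeval p f * t'
  t_t' : ∃ f : ℂ[X], t * t' = aeval p f

lemma exists_mul_aeval {p x : A} (h : ∃ c : ℂ, x * p = c • (p * x)) (f : ℂ[X]) :
    ∃ g : ℂ[X], x * aeval p f = aeval p g * x := by
  obtain ⟨c, hc⟩ := h
  induction f using Polynomial.induction_on' with
  | add f₁ f₂ h₁ h₂ =>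
    obtain ⟨g₁, h₁⟩ := h₁
    obtain ⟨g₂, h₂⟩ := h₂
    exact ⟨g₁ + g₂, by rw [map_add, map_add, mul_add, add_mul, h₁, h₂]⟩
  | monomial n a =>
    have key : x * p ^ n = c ^ n • (p ^ n * x) := by
      induction n with
      | zero => simp
      | succ n ih =>
        rw [pow_succ, ← mul_assoc, ih, smul_mul_assoc, mul_assoc, hc, mul_smul_comm, smul_smul,
          ← pow_succ, mul_assoc]
    refine ⟨monomial n (a * c ^ n), ?_⟩
    simp only [aeval_monomial, ← Algebra.smul_def, mul_smul_comm, key, smul_smul, smul_mul_assoc]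

lemma HalfRel.t_mul_mono {p r t r' t' : A} (h : HalfRel p r t r' t') (n : ℕ) :
    ∃ f : ℂ[X], t * mono r t n = aeval p f * mono r t (n + 1) := by
  induction n using Nat.twoStepInduction with
  | zero => exact ⟨1, by simp [mono]⟩
  | one =>
    obtain ⟨c, hc⟩ := h.t_t
    exact ⟨c • X, by simp [mono, hc]⟩
  | more n ih _ =>
    obtain ⟨f, hf⟩ := ih
    obtain ⟨c, hc⟩ := h.t_r
    obtain ⟨g, hg⟩ := exists_mul_aeval h.r_p f
    refine ⟨c • g, ?_⟩
    calc t * mono r t (n + 2) = (t * r) * mono r t n := by rw [mono, mul_assoc]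
      _ = c • (r * (t * mono r t n)) := by rw [hc, smul_mul_assoc, mul_assoc]
      _ = c • ((r * aeval p f) * mono r t (n + 1)) := by rw [hf, mul_assoc]
      _ = aeval p (c • g) * mono r t (n + 2 + 1) := by
        rw [hg, map_smul, smul_mul_assoc, mul_assoc, mono]

/-- The span of the elements `f(p) * m` with `m` a monomial in `r, t` or in `r', t'`. -/
def monoSpan (p r t r' t' : A) : Submodule ℂ A :=
  Submodule.span ℂ
    ({y | ∃ (f : ℂ[X]) (n : ℕ), y = aeval p f * mono r t n} ∪
      {y | ∃ (f : ℂ[X]) (n : ℕ), y = aeval p f * mono r' t' n})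

lemma monoSpan_swap (p r t r' t' : A) : monoSpan p r t r' t' = monoSpan p r' t' r t := by
  rw [monoSpan, monoSpan, Set.union_comm]

lemma aeval_mul_mono_mem (p r t r' t' : A) (f : ℂ[X]) (n : ℕ) :
    aeval p f * mono r t n ∈ monoSpan p r t r' t' :=
  Submodule.subset_span (Or.inl ⟨f, n, rfl⟩)

lemma aeval_mul_mono_mem' (p r t r' t' : A) (f : ℂ[X]) (n : ℕ) :
    aeval p f * mono r' t' n ∈ monoSpan p r t r' t' :=
  Submodule.subset_span (Or.inr ⟨f, n, rfl⟩)

lemma mul_mem_monoSpan {p r t r' t' x y : A}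
    (h : ∀ (f : ℂ[X]) n, x * (aeval p f * mono r t n) ∈ monoSpan p r t r' t')
    (h' : ∀ (f : ℂ[X]) n, x * (aeval p f * mono r' t' n) ∈ monoSpan p r t r' t')
    (hy : y ∈ monoSpan p r t r' t') : x * y ∈ monoSpan p r t r' t' := by
  have hle : monoSpan p r t r' t' ≤
      (monoSpan p r t r' t').comap (LinearMap.mulLeft ℂ x) := by
    refine Submodule.span_le.2 ?_
    rintro _ (⟨f, n, rfl⟩ | ⟨f, n, rfl⟩)
    · exact h f n
    · exact h' f n
  exact hle hy

lemma aeval_mul_mem_monoSpan (p r t r' t' : A) (g : ℂ[X]) {y : A}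
    (hy : y ∈ monoSpan p r t r' t') : aeval p g * y ∈ monoSpan p r t r' t' := by
  refine mul_mem_monoSpan (fun f n => ?_) (fun f n => ?_) hy
  · simpa [mul_assoc] using aeval_mul_mono_mem p r t r' t' (g * f) n
  · simpa [mul_assoc] using aeval_mul_mono_mem' p r t r' t' (g * f) n

/-- An element that commutes with `p` up to a scalar preserves `monoSpan` as soon as it maps
the monomials into it. -/
lemma mul_mem_monoSpan_of_mono {p r t r' t' x y : A} (hx : ∃ c : ℂ, x * p = c • (p * x))
    (h : ∀ n, x * mono r t n ∈ monoSpan p r t r' t')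
    (h' : ∀ n, x * mono r' t' n ∈ monoSpan p r t r' t')
    (hy : y ∈ monoSpan p r t r' t') : x * y ∈ monoSpan p r t r' t' := by
  refine mul_mem_monoSpan (fun f n => ?_) (fun f n => ?_) hy <;>
    obtain ⟨g, hg⟩ := exists_mul_aeval hx f <;>
    rw [← mul_assoc, hg, mul_assoc]
  · exact aeval_mul_mem_monoSpan p r t r' t' g (h n)
  · exact aeval_mul_mem_monoSpan p r t r' t' g (h' n)

lemma mono_mem (p r t r' t' : A) (n : ℕ) : mono r t n ∈ monoSpan p r t r' t' := by
  simpa using aeval_mul_mono_mem p r t r' t' 1 n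

lemma HalfRel.r_mul_mem {p r t r' t' : A} (h : HalfRel p r t r' t') {y : A}
    (hy : y ∈ monoSpan p r t r' t') : r * y ∈ monoSpan p r t r' t' := by
  refine mul_mem_monoSpan_of_mono h.r_p (fun n => mono_mem p r t r' t' (n + 2)) ?_ hy
  rintro (_ | _ | n)
  · exact mono_mem p r t r' t' 2
  · obtain ⟨f, hf⟩ := h.r_t'
    change r * t' ∈ _
    rw [hf]
    exact aeval_mul_mono_mem p r t r' t' f 1
  · obtain ⟨f, hf⟩ := h.r_r'
    rw [mono, ← mul_assoc, hf]
    exact aeval_mul_mono_mem' p r t r' t' f n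

lemma HalfRel.t_mul_mem {p r t r' t' : A} (h : HalfRel p r t r' t') (h' : HalfRel p r' t' r t)
    {y : A} (hy : y ∈ monoSpan p r t r' t') : t * y ∈ monoSpan p r t r' t' := by
  refine mul_mem_monoSpan_of_mono h.t_p (fun n => ?_) ?_ hy
  · obtain ⟨f, hf⟩ := h.t_mul_mono n
    rw [hf]
    exact aeval_mul_mono_mem p r t r' t' f _
  · rintro (_ | _ | n)
    · simpa [mono] using mono_mem p r t r' t' 1
    · obtain ⟨f, hf⟩ := h.t_t'
      change t * t' ∈ _
      rw [hf]
      simpa [mono] using aeval_mul_mono_mem p r t r' t' f 0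
    · obtain ⟨f, hf⟩ := h.t_r'
      obtain ⟨g, hg⟩ := h'.t_mul_mono n
      rw [mono, ← mul_assoc, hf, mul_assoc, hg]
      exact aeval_mul_mem_monoSpan _ _ _ _ _ _ (aeval_mul_mono_mem' p r t r' t' g _)

lemma exists_finsupp_of_mem_monoSpan {p r t r' t' y : A} (hy : y ∈ monoSpan p r t r' t') :
    ∃ c : ℤ →₀ ℂ[X], y = c.sum fun n f => aeval p f * intMono r t r' t' n := by
  let L : (ℤ →₀ ℂ[X]) →ₗ[ℂ] A := Finsupp.lsum ℂ fun n =>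
    (LinearMap.mulRight ℂ (intMono r t r' t' n)).comp (aeval p : ℂ[X] →ₐ[ℂ] A).toLinearMap
  have hle : monoSpan p r t r' t' ≤ LinearMap.range L := by
    refine Submodule.span_le.2 ?_
    rintro _ (⟨f, n, rfl⟩ | ⟨f, n, rfl⟩)
    · exact ⟨Finsupp.single (n : ℤ) f, by simp [L, intMono_natCast]⟩
    · exact ⟨Finsupp.single (-n : ℤ) f, by simp [L, intMono_neg_natCast]⟩
  obtain ⟨c, rfl⟩ := hle hy
  exact ⟨c, rfl⟩

end Spanning

section Relations

variable (q : ℝ)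

local notation "π" => RingQuot.mkAlgHom ℂ (RP2.Rel q)

lemma mkAlgHom_eq {x y : FreeAlgebra ℂ (Fin 5)} (h : RP2.Rel q x y) : π x = π y :=
  RingQuot.mkAlgHom_rel ℂ h

variable {q}

lemma halfRel (hq : q ≠ 0) : HalfRel (π P) (π R) (π T) (π R') (π T') where
  r_p := ⟨(q : ℂ) ^ 8, by simpa using mkAlgHom_eq q .rel1⟩
  t_p := ⟨(q : ℂ) ^ 4, by
    have h := mkAlgHom_eq q .rel3
    simp only [map_mul, map_smul] at h
    rw [h, smul_smul, mul_inv_cancel₀ (by simpa using hq), one_smul]⟩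
  t_r := ⟨((q : ℂ) ^ 4)⁻¹, by
    have h := mkAlgHom_eq q .rel2
    simp only [map_mul, map_smul] at h
    rw [h, smul_smul, inv_mul_cancel₀ (by simpa using hq), one_smul]⟩
  t_t := ⟨(q : ℂ) ^ 2, by simpa using mkAlgHom_eq q .rel4⟩
  r_r' := ⟨(q : ℂ) ^ 12 • (X * X) - ((q : ℂ) ^ 4 * (1 + (q : ℂ) ^ 4)) • X + 1, by
    have h := mkAlgHom_eq q .rel7
    simp only [map_mul, map_smul, map_add, map_sub, map_one] at h
    simp only [map_mul, map_smul, map_add, map_sub, map_one, aeval_X, h]⟩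
  r_t' := ⟨(q : ℂ) ^ 2 • (1 - ((q : ℂ) ^ 4 * (q : ℂ) ^ 4) • X), by
    have h := mkAlgHom_eq q .rel5
    have h3 := mkAlgHom_eq q .rel3
    simp only [map_mul, map_smul, map_sub, map_one] at h h3
    have h3' : π T * π P = (q : ℂ) ^ 4 • (π P * π T) := by
      rw [h3, smul_smul, mul_inv_cancel₀ (by simpa using hq), one_smul]
    rw [h]
    simp only [map_smul, map_sub, map_one, aeval_X, mul_sub, sub_mul, mul_one, one_mul,
      smul_mul_assoc, mul_smul_comm, h3', smul_smul]⟩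
  t_r' := ⟨(q : ℂ) ^ 2 • (1 - (q : ℂ) ^ 4 • X), by
    have h := mkAlgHom_eq q .rel15
    simp only [map_mul, map_smul, map_sub, map_one] at h
    simp only [map_smul, map_sub, map_one, aeval_X, h, smul_mul_assoc]⟩
  t_t' := ⟨X - (q : ℂ) ^ 4 • (X * X), by
    have h := mkAlgHom_eq q .rel9
    simp only [map_mul, map_smul, map_sub] at h
    simp only [map_mul, map_smul, map_sub, aeval_X, h]⟩

lemma halfRel' (hq : q ≠ 0) : HalfRel (π P) (π R') (π T') (π R) (π T) where
  r_p := ⟨((q : ℂ) ^ 8)⁻¹, by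
    have h := mkAlgHom_eq q .rel11
    simp only [map_mul, map_smul] at h
    rw [h, smul_smul, inv_mul_cancel₀ (by simpa using hq), one_smul]⟩
  t_p := ⟨((q : ℂ) ^ 4)⁻¹, by simpa using mkAlgHom_eq q .rel13⟩
  t_r := ⟨(q : ℂ) ^ 4, by simpa using mkAlgHom_eq q .rel12⟩
  t_t := ⟨(q : ℂ) ^ 2 * ((q : ℂ) ^ 8)⁻¹, by
    have h := mkAlgHom_eq q .rel14
    have h11 := mkAlgHom_eq q .rel11
    simp only [map_mul, map_smul] at h h11
    rw [h, h11, smul_smul, mul_assoc, inv_mul_cancel₀ (by simpa using hq), mul_one]⟩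
  r_r' := ⟨((q : ℂ) ^ 4)⁻¹ • (X * X) - (1 + ((q : ℂ) ^ 4)⁻¹) • X + 1, by
    have h := mkAlgHom_eq q .rel8
    simp only [map_mul, map_smul, map_add, map_sub, map_one] at h
    simp only [map_mul, map_smul, map_add, map_sub, map_one, aeval_X, h]⟩
  r_t' := ⟨((q : ℂ) ^ 2)⁻¹ • (1 - ((q : ℂ) ^ 4)⁻¹ • X), by
    have h := mkAlgHom_eq q .rel6
    have h13 := mkAlgHom_eq q .rel13
    simp only [map_mul, map_smul, map_sub, map_one] at h h13
    rw [h, mul_sub, h13]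
    simp only [map_smul, map_sub, map_one, aeval_X, sub_mul, mul_one, one_mul, smul_mul_assoc]⟩
  t_r' := ⟨((q : ℂ) ^ 2)⁻¹ • (1 - X), by
    have h := mkAlgHom_eq q .rel16
    simp only [map_mul, map_smul, map_sub, map_one] at h
    simp only [map_smul, map_sub, map_one, aeval_X, h, smul_mul_assoc]⟩
  t_t' := ⟨((q : ℂ) ^ 4)⁻¹ • (X - X * X), by
    have h := mkAlgHom_eq q .rel10
    simp only [map_mul, map_smul, map_sub] at h
    simp only [map_mul, map_smul, map_sub, aeval_X, h]⟩

lemma mem_monoSpan (hq : q ≠ 0) (y : RingQuot (RP2.Rel q)) :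
    y ∈ monoSpan (π P) (π R) (π T) (π R') (π T') := by
  have h := halfRel hq
  have h' := halfRel' hq
  suffices key : ∀ z : FreeAlgebra ℂ (Fin 5), ∀ s ∈ monoSpan (π P) (π R) (π T) (π R') (π T'),
      π z * s ∈ monoSpan (π P) (π R) (π T) (π R') (π T') by
    obtain ⟨z, rfl⟩ := RingQuot.mkAlgHom_surjective ℂ (RP2.Rel q) y
    simpa using key z 1 (by simpa [mono] using mono_mem (π P) (π R) (π T) (π R') (π T') 0)
  intro z
  induction z using FreeAlgebra.induction with
  | grade0 a =>
    intro s hs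
    rw [AlgHom.commutes, ← Algebra.smul_def]
    exact Submodule.smul_mem _ _ hs
  | grade1 i =>
    intro s hs
    fin_cases i
    · have hP := aeval_mul_mem_monoSpan _ _ _ _ _ X hs
      rwa [aeval_X] at hP
    · exact h.r_mul_mem hs
    · rw [monoSpan_swap] at hs ⊢
      exact h'.r_mul_mem hs
    · exact h.t_mul_mem h' hs
    · rw [monoSpan_swap] at hs ⊢
      exact h'.t_mul_mem h hs
  | mul a b ha hb =>
    intro s hs
    rw [map_mul, mul_assoc]
    exact ha _ (hb _ hs)
  | add a b ha hb =>
    intro s hs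
    rw [map_add, add_mul]
    exact Submodule.add_mem _ (ha _ hs) (hb _ hs)

end Relations

section Representation

variable {H : Type*} [NormedAddCommGroup H] [InnerProductSpace ℂ H]

open ContinuousLinearMap

lemma adjoint_apply_of_shift [CompleteSpace H] (e : HilbertBasis ℕ ℂ H) (S : H →L[ℂ] H)
    (d : ℕ) (a : ℕ → ℂ)
    (h0 : ∀ j < d, S (e j) = 0) (h : ∀ k, S (e (k + d)) = a k • e k) (k : ℕ) :
    adjoint S (e k) = (starRingEnd ℂ) (a k) • e (k + d) := by
  apply e.repr.injective
  ext j
  rw [e.repr_apply_apply, e.repr_apply_apply, adjoint_inner_right, inner_smul_right,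
    orthonormal_iff_ite.1 e.orthonormal]
  rcases lt_or_ge j d with hj | hj
  · rw [h0 j hj, inner_zero_left, if_neg (by omega), mul_zero]
  · obtain ⟨i, rfl⟩ := Nat.exists_eq_add_of_le' hj
    rw [h, inner_smul_left, orthonormal_iff_ite.1 e.orthonormal]
    by_cases hik : i = k
    · simp [hik]
    · simp [hik]

lemma mono_apply_of_lowering {e : ℕ → H} {r t : H →L[ℂ] H}
    (hr : ∀ k, ∃ a : ℂ, a ≠ 0 ∧ r (e (k + 2)) = a • e k)
    (ht : ∀ k, ∃ a : ℂ, a ≠ 0 ∧ t (e (k + 1)) = a • e k) (n k : ℕ) :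
    ∃ a : ℂ, a ≠ 0 ∧ mono r t n (e (k + n)) = a • e k := by
  induction n using Nat.twoStepInduction generalizing k with
  | zero => exact ⟨1, one_ne_zero, by simp [mono]⟩
  | one => exact ht k
  | more n ih _ =>
    obtain ⟨a, ha, h⟩ := ih (k + 2)
    obtain ⟨b, hb, h'⟩ := hr k
    refine ⟨a * b, mul_ne_zero ha hb, ?_⟩
    rw [mono, mul_apply_eq_comp, show k + (n + 2) = k + 2 + n by ring, h, map_smul, h', smul_smul]

lemma mono_apply_of_raising {e : ℕ → H} {r t : H →L[ℂ] H}
    (hr : ∀ k, ∃ a : ℂ, a ≠ 0 ∧ r (e k) = a • e (k + 2))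
    (ht : ∀ k, ∃ a : ℂ, a ≠ 0 ∧ t (e k) = a • e (k + 1)) (n k : ℕ) :
    ∃ a : ℂ, a ≠ 0 ∧ mono r t n (e k) = a • e (k + n) := by
  induction n using Nat.twoStepInduction with
  | zero => exact ⟨1, one_ne_zero, by simp [mono]⟩
  | one => exact ht k
  | more n ih _ =>
    obtain ⟨a, ha, h⟩ := ih
    obtain ⟨b, hb, h'⟩ := hr (k + n)
    refine ⟨a * b, mul_ne_zero ha hb, ?_⟩
    rw [mono, mul_apply_eq_comp, h, map_smul, h', smul_smul, add_assoc]

lemma intMono_apply {e : ℕ → H} {r t r' t' : H →L[ℂ] H}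
    (hr : ∀ k, ∃ a : ℂ, a ≠ 0 ∧ r (e (k + 2)) = a • e k)
    (ht : ∀ k, ∃ a : ℂ, a ≠ 0 ∧ t (e (k + 1)) = a • e k)
    (hr' : ∀ k, ∃ a : ℂ, a ≠ 0 ∧ r' (e k) = a • e (k + 2))
    (ht' : ∀ k, ∃ a : ℂ, a ≠ 0 ∧ t' (e k) = a • e (k + 1)) (n : ℤ) (j k : ℕ)
    (hjk : (k : ℤ) = j + n) :
    ∃ a : ℂ, a ≠ 0 ∧ intMono r t r' t' n (e k) = a • e j := by
  obtain ⟨m, rfl | rfl⟩ := n.eq_nat_or_neg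
  · obtain rfl : k = j + m := by omega
    rw [intMono_natCast]
    exact mono_apply_of_lowering hr ht m j
  · obtain rfl : j = k + m := by omega
    rw [intMono_neg_natCast]
    exact mono_apply_of_raising hr' ht' m k

lemma aeval_apply_of_eigenvector {p : H →L[ℂ] H} {v : H} {a : ℂ} (h : p v = a • v) (f : ℂ[X]) :
    aeval p f v = f.eval a • v := by
  induction f using Polynomial.induction_on' with
  | add f₁ f₂ h₁ h₂ => rw [map_add, add_apply, h₁, h₂, eval_add, add_smul]
  | monomial n b =>
    have key : (p ^ n) v = a ^ n • v := by
      induction n with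
      | zero => simp
      | succ n ih => rw [pow_succ, mul_apply_eq_comp, h, map_smul, ih, smul_smul, pow_succ']
    rw [aeval_monomial, ← Algebra.smul_def, smul_apply, key, eval_monomial, smul_smul]

/-- Linear independence over `ℂ[p]` of operators shifting an orthonormal basis of eigenvectors
of `p`, with distinct eigenvalues, by distinct degrees. -/
lemma eq_zero_of_sum_aeval_mul_shift {e : ℕ → H} (he : Orthonormal ℂ e) {p : H →L[ℂ] H}
    {s : ℤ → H →L[ℂ] H} {ev : ℕ → ℂ} (hev : Function.Injective ev)
    (hp : ∀ k, p (e k) = ev k • e k)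
    (hs : ∀ (n : ℤ) (j k : ℕ), (k : ℤ) = j + n → ∃ a : ℂ, a ≠ 0 ∧ s n (e k) = a • e j)
    {c : ℤ →₀ ℂ[X]} (hc : (c.sum fun n f => aeval p f * s n) = 0) : c = 0 := by
  obtain ⟨N, hN⟩ : ∃ N : ℕ, ∀ n ∈ c.support, n ≤ N := by
    obtain ⟨M, hM⟩ := c.support.bddAbove
    exact ⟨M.toNat, fun n hn => (hM hn).trans M.self_le_toNat⟩
  ext1 n
  by_contra hn
  have hmem : n ∈ c.support := Finsupp.mem_support_iff.2 hn
  have hroot : ∀ i : ℕ, (c n).eval (ev ((N - n).toNat + i)) = 0 := by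
    intro i
    have hnN := hN n hmem
    obtain ⟨a, ha, hsa⟩ := hs n ((N - n).toNat + i) (N + i) (by push_cast; omega)
    have hzero := congrArg (fun S : H →L[ℂ] H =>
      inner ℂ (e ((N - n).toNat + i)) (S (e (N + i)))) hc
    simp only [Finsupp.sum, sum_apply, inner_sum, zero_apply, inner_zero_right] at hzero
    rw [Finset.sum_eq_single n ?_ (fun h => absurd hmem h)] at hzero
    · rw [mul_apply_eq_comp, hsa, map_smul, aeval_apply_of_eigenvector (hp _), smul_smul,
        inner_smul_right, orthonormal_iff_ite.1 he, if_pos rfl, mul_one] at hzero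
      exact (mul_eq_zero.1 hzero).resolve_left ha
    · intro m hm hmn
      have hmN := hN m hm
      obtain ⟨b, -, hsb⟩ := hs m ((N - m).toNat + i) (N + i) (by push_cast; omega)
      rw [mul_apply_eq_comp, hsb, map_smul, aeval_apply_of_eigenvector (hp _), smul_smul,
        inner_smul_right, orthonormal_iff_ite.1 he, if_neg (by omega), mul_zero]
  refine hn (Polynomial.eq_zero_of_infinite_isRoot _ (Set.Infinite.mono ?_
    (Set.infinite_range_of_injective
      (hev.comp (add_right_injective (N - n).toNat)))))
  rintro _ ⟨i, rfl⟩
  exact hroot i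

end Representation

lemma map_mono {A B : Type*} [Ring A] [Algebra ℂ A] [Ring B] [Algebra ℂ B] (φ : A →ₐ[ℂ] B)
    (r t : A) (n : ℕ) : φ (mono r t n) = mono (φ r) (φ t) n := by
  induction n using Nat.twoStepInduction with
  | zero => simp [mono]
  | one => simp [mono]
  | more n ih _ => rw [mono, mono, map_mul, ih]

lemma map_intMono {A B : Type*} [Ring A] [Algebra ℂ A] [Ring B] [Algebra ℂ B] (φ : A →ₐ[ℂ] B)
    (r t r' t' : A) (n : ℤ) :
    φ (intMono r t r' t' n) = intMono (φ r) (φ t) (φ r') (φ t') n := by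
  rw [intMono, intMono, apply_ite φ, map_mono, map_mono]

end RP2

open ContinuousLinearMap RP2 in
/-- The unital `ℂ`-algebra homomorphism `ρ` from `O(ℝP²_q)` to the bounded
operators on `ℓ²(ℕ)` determined by `P ↦ ρP`, `R ↦ ρR`, `T ↦ ρT`, `R′ ↦ ρR*`, `T′ ↦ ρT*`
is injective; i.e. the infinite-dimensional irreducible representation `ρ` is faithful. -/
theorem stmt14 {H : Type*} [NormedAddCommGroup H] [InnerProductSpace ℂ H] [CompleteSpace H]
    (e : HilbertBasis ℕ ℂ H) (q : ℝ) (hq0 : 0 < q) (hq1 : q < 1)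
    (ρP ρT ρR : H →L[ℂ] H)
    (hP : ∀ k : ℕ, ρP (e k) = ((q ^ (4 * k) : ℝ) : ℂ) • e k)
    (hT0 : ρT (e 0) = 0)
    (hT : ∀ k : ℕ, ρT (e (k + 1)) =
      ((q ^ (2 * k) * Real.sqrt (1 - q ^ (4 * (k + 1))) : ℝ) : ℂ) • e k)
    (hR0 : ρR (e 0) = 0) (hR1 : ρR (e 1) = 0)
    (hR : ∀ k : ℕ, ρR (e (k + 2)) =
      ((Real.sqrt ((1 - q ^ (4 * (k + 2))) * (1 - q ^ (4 * (k + 1)))) : ℝ) : ℂ) • e k)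
    (ρ : RingQuot (RP2.Rel q) →ₐ[ℂ] (H →L[ℂ] H))
    (hρP : ρ (RingQuot.mkAlgHom ℂ (RP2.Rel q) P) = ρP)
    (hρR : ρ (RingQuot.mkAlgHom ℂ (RP2.Rel q) R) = ρR)
    (hρR' : ρ (RingQuot.mkAlgHom ℂ (RP2.Rel q) R') = adjoint ρR)
    (hρT : ρ (RingQuot.mkAlgHom ℂ (RP2.Rel q) T) = ρT)
    (hρT' : ρ (RingQuot.mkAlgHom ℂ (RP2.Rel q) T') = adjoint ρT) :
    Function.Injective ρ := by
  have hlt : ∀ k : ℕ, 0 < 1 - q ^ (4 * (k + 1)) := fun k =>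
    sub_pos.2 (pow_lt_one₀ hq0.le hq1 (by omega))
  have hTne : ∀ k : ℕ, ((q ^ (2 * k) * Real.sqrt (1 - q ^ (4 * (k + 1))) : ℝ) : ℂ) ≠ 0 :=
    fun k => Complex.ofReal_ne_zero.2 (mul_pos (pow_pos hq0 _) (Real.sqrt_pos.2 (hlt k))).ne'
  have hRne : ∀ k : ℕ, ((Real.sqrt ((1 - q ^ (4 * (k + 2))) * (1 - q ^ (4 * (k + 1)))) : ℝ) : ℂ)
      ≠ 0 :=
    fun k => Complex.ofReal_ne_zero.2 (Real.sqrt_pos.2 (mul_pos (hlt (k + 1)) (hlt k))).ne'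
  have hT' := adjoint_apply_of_shift e ρT 1 _
    (fun j hj => by rwa [Nat.lt_one_iff.1 hj]) hT
  have hR' := adjoint_apply_of_shift e ρR 2 _
    (fun j hj => by interval_cases j <;> assumption) hR
  rw [injective_iff_map_eq_zero]
  intro y hy
  obtain ⟨c, rfl⟩ := exists_finsupp_of_mem_monoSpan (mem_monoSpan hq0.ne' y)
  suffices hc : c = 0 by simp [hc]
  refine eq_zero_of_sum_aeval_mul_shift e.orthonormal (p := ρP)
    (s := intMono ρR ρT (adjoint ρR) (adjoint ρT)) (ev := fun k => ((q ^ (4 * k) : ℝ) : ℂ))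
    ?_ hP ?_ ?_
  · intro i j hij
    have := pow_right_injective₀ hq0 hq1.ne (Complex.ofReal_injective hij)
    omega
  · exact intMono_apply (fun k => ⟨_, hRne k, hR k⟩) (fun k => ⟨_, hTne k, hT k⟩)
      (fun k => ⟨_, (map_ne_zero _).2 (hRne k), hR' k⟩)
      (fun k => ⟨_, (map_ne_zero _).2 (hTne k), hT' k⟩)
  · rw [← hy, map_finsuppSum]
    refine Finsupp.sum_congr fun n _ => ?_
    rw [map_mul, map_intMono, ← Polynomial.aeval_algHom_apply, hρP, hρR, hρR', hρT, hρT']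
end

section
/- Let q be a real number with 0 < q < 1 and let O(ℝP²_q) be the coordinate *-algebra of the quantum real projective plane (presented by generators P, R, R′, T, T′ and the relations listed in the context). Then the cosets of the monomials P^k R^l (k, l ∈ ℕ), P^k (R′)^l (k ∈ ℕ, l ∈ ℕ \ {0}), P^k R^l T (k, l ∈ ℕ), and P^k (R′)^l T′ (k, l ∈ ℕ) form a basis of O(ℝP²_q) as a ℂ-vector space. -/
namespace RP2

/-- The words in `R, R′, T, T′` that span `O(ℝP²_q)` as a left module over the polynomials in `P`. -/
def word {A : Type*} [Monoid A] (r r' t t' : A) : ℕ ⊕ (ℕ ⊕ (ℕ ⊕ ℕ)) → A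
  | Sum.inl l => r ^ l
  | Sum.inr (Sum.inl l) => r' ^ (l + 1)
  | Sum.inr (Sum.inr (Sum.inl l)) => r ^ l * t
  | Sum.inr (Sum.inr (Sum.inr l)) => r' ^ l * t'

section Span

variable {A : Type*} [Ring A] [Algebra ℂ A]

theorem mul_pow_of_mul_eq_smul {g p : A} {c : ℂ} (h : g * p = c • (p * g)) (k : ℕ) :
    g * p ^ k = c ^ k • (p ^ k * g) := by
  induction k with
  | zero => simp
  | succ k ih =>
    rw [pow_succ, ← mul_assoc, ih, smul_mul_assoc, mul_assoc, h, mul_smul_comm, smul_smul,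
      ← mul_assoc, pow_succ]

/-- The span of the products of a power of `p` with one of the words. -/
def wordSpan (p r r' t t' : A) : Submodule ℂ A :=
  Submodule.span ℂ (Set.range fun i : ℕ × (ℕ ⊕ (ℕ ⊕ (ℕ ⊕ ℕ))) => p ^ i.1 * word r r' t t' i.2)

variable {p r r' t t' : A}

theorem word_mem_wordSpan (i) : word r r' t t' i ∈ wordSpan p r r' t t' :=
  Submodule.subset_span ⟨(0, i), by simp⟩

theorem mul_mem_wordSpan_of_forall_word {g : A}
    (h : ∀ k i, g * (p ^ k * word r r' t t' i) ∈ wordSpan p r r' t t')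
    {x : A} (hx : x ∈ wordSpan p r r' t t') : g * x ∈ wordSpan p r r' t t' := by
  induction hx using Submodule.span_induction with
  | mem x hx => obtain ⟨i, rfl⟩ := hx; exact h _ _
  | zero => simp
  | add x y _ _ hx hy => rw [mul_add]; exact add_mem hx hy
  | smul c x _ hx => rw [mul_smul_comm]; exact Submodule.smul_mem _ _ hx

theorem base_mul_mem_wordSpan {x : A} (hx : x ∈ wordSpan p r r' t t') :
    p * x ∈ wordSpan p r r' t t' :=
  mul_mem_wordSpan_of_forall_word
    (fun k i => Submodule.subset_span ⟨(k + 1, i), by simp [pow_succ', mul_assoc]⟩) hx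

theorem mul_mem_wordSpan {g : A} {c : ℂ} (hg : g * p = c • (p * g))
    (h : ∀ i, g * word r r' t t' i ∈ wordSpan p r r' t t')
    {x : A} (hx : x ∈ wordSpan p r r' t t') : g * x ∈ wordSpan p r r' t t' := by
  refine mul_mem_wordSpan_of_forall_word (fun k i => ?_) hx
  rw [← mul_assoc, mul_pow_of_mul_eq_smul hg, smul_mul_assoc, mul_assoc]
  refine Submodule.smul_mem _ _ ?_
  induction k with
  | zero => simpa using h i
  | succ k ih => rw [pow_succ', mul_assoc]; exact base_mul_mem_wordSpan ih

theorem aeval_mul_mem_wordSpan (f : Polynomial ℂ) {x : A} (hx : x ∈ wordSpan p r r' t t') :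
    Polynomial.aeval p f * x ∈ wordSpan p r r' t t' := by
  induction f using Polynomial.induction_on' with
  | add f g hf hg => rw [map_add, add_mul]; exact add_mem hf hg
  | monomial n a =>
    rw [Polynomial.aeval_monomial, mul_assoc, ← Algebra.smul_def]
    refine Submodule.smul_mem _ _ ?_
    induction n with
    | zero => simpa using hx
    | succ k ih => rw [pow_succ', mul_assoc]; exact base_mul_mem_wordSpan ih

open Polynomial in
/-- If the images of the generators satisfy the relations, then the span of the monomials is
stable under left multiplication by the image of the free algebra. -/
theorem map_mul_mem_wordSpan {q : ℝ} (hq : q ≠ 0) (φ : FreeAlgebra ℂ (Fin 5) →ₐ[ℂ] A)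
    (hφ : ∀ ⦃x y⦄, Rel q x y → φ x = φ y) (y : FreeAlgebra ℂ (Fin 5)) {x : A}
    (hx : x ∈ wordSpan (φ P) (φ R) (φ R') (φ T) (φ T')) :
    φ y * x ∈ wordSpan (φ P) (φ R) (φ R') (φ T) (φ T') := by
  have hc : (q : ℂ) ≠ 0 := by exact_mod_cast hq
  have rel1 := hφ .rel1
  have rel2 := hφ .rel2
  have rel3 := hφ .rel3
  have rel4 := hφ .rel4
  have rel5 := hφ .rel5
  have rel6 := hφ .rel6
  have rel7 := hφ .rel7
  have rel8 := hφ .rel8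
  have rel9 := hφ .rel9
  have rel10 := hφ .rel10
  have rel11 := hφ .rel11
  have rel12 := hφ .rel12
  have rel13 := hφ .rel13
  have rel14 := hφ .rel14
  have rel15 := hφ .rel15
  have rel16 := hφ .rel16
  simp only [map_mul, map_smul, map_add, map_sub, map_one] at *
  set p := φ P
  set r := φ R
  set r' := φ R'
  set t := φ T
  set t' := φ T'
  set c := (q : ℂ)
  set S := wordSpan p r r' t t'
  have one_mem : (1 : A) ∈ S := by simpa [word] using word_mem_wordSpan (p := p) (.inl 0)
  have t_mem : t ∈ S := by
    simpa [word] using word_mem_wordSpan (p := p) (.inr (.inr (.inl 0)))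
  have t'_mem : t' ∈ S := by
    simpa [word] using word_mem_wordSpan (p := p) (.inr (.inr (.inr 0)))
  have r_pow (l : ℕ) : r ^ l ∈ S := word_mem_wordSpan (.inl l)
  have r'_pow (l : ℕ) : r' ^ l ∈ S := by
    cases l with
    | zero => simpa using one_mem
    | succ l => exact word_mem_wordSpan (.inr (.inl l))
  have r_pow_t (l : ℕ) : r ^ l * t ∈ S := word_mem_wordSpan (.inr (.inr (.inl l)))
  have r'_pow_t' (l : ℕ) : r' ^ l * t' ∈ S := word_mem_wordSpan (.inr (.inr (.inr l)))
  have poly_mul (f : ℂ[X]) {x : A} (hx : x ∈ S) : aeval p f * x ∈ S :=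
    aeval_mul_mem_wordSpan f hx
  have tp : t * p = c ^ 4 • (p * t) := by
    rw [rel3, smul_smul, mul_inv_cancel₀ (pow_ne_zero _ hc), one_smul]
  have r'p : r' * p = (c ^ 8)⁻¹ • (p * r') := by
    rw [rel11, smul_smul, inv_mul_cancel₀ (pow_ne_zero _ hc), one_smul]
  have tr : t * r = (c ^ 4)⁻¹ • (r * t) := by
    rw [rel2, smul_smul, inv_mul_cancel₀ (pow_ne_zero _ hc), one_smul]
  have rr' : ∃ f : ℂ[X], r * r' = aeval p f :=
    ⟨c ^ 12 • (X * X) - (c ^ 4 * (1 + c ^ 4)) • X + 1, by simp [rel7]⟩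
  have r'r : ∃ f : ℂ[X], r' * r = aeval p f :=
    ⟨(c ^ 4)⁻¹ • (X * X) - (1 + (c ^ 4)⁻¹) • X + 1, by simp [rel8]⟩
  have rt' : ∃ f : ℂ[X], r * t' = aeval p f * t :=
    ⟨c ^ 2 • (1 - (c ^ 4 * c ^ 4) • X), by
      simp [rel5, mul_sub, sub_mul, tp, smul_smul]⟩
  have r't : ∃ f : ℂ[X], r' * t = aeval p f * t' :=
    ⟨(c ^ 2)⁻¹ • (1 - (c ^ 4)⁻¹ • X), by simp [rel6, mul_sub, sub_mul, rel13]⟩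
  have tt' : ∃ f : ℂ[X], t * t' = aeval p f := ⟨X - c ^ 4 • (X * X), by simp [rel9]⟩
  have t't : ∃ f : ℂ[X], t' * t = aeval p f :=
    ⟨(c ^ 4)⁻¹ • (X - X * X), by simp [rel10]⟩
  have tr' : ∃ f : ℂ[X], t * r' = aeval p f * t' :=
    ⟨c ^ 2 • (1 - c ^ 4 • X), by simp [rel15]⟩
  have t'r : ∃ f : ℂ[X], t' * r = aeval p f * t :=
    ⟨(c ^ 2)⁻¹ • (1 - X), by simp [rel16]⟩
  obtain ⟨frr', rr'⟩ := rr'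
  obtain ⟨fr'r, r'r⟩ := r'r
  obtain ⟨frt', rt'⟩ := rt'
  obtain ⟨fr't, r't⟩ := r't
  obtain ⟨ftt', tt'⟩ := tt'
  obtain ⟨ft't, t't⟩ := t't
  obtain ⟨ftr', tr'⟩ := tr'
  obtain ⟨ft'r, t'r⟩ := t'r
  have r_mul {x : A} (hx : x ∈ S) : r * x ∈ S := by
    refine mul_mem_wordSpan rel1 ?_ hx
    rintro (l | l | l | l) <;> simp only [word]
    · simpa [pow_succ'] using r_pow (l + 1)
    · rw [pow_succ', ← mul_assoc, rr']
      exact poly_mul _ (r'_pow l)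
    · simpa [pow_succ', mul_assoc] using r_pow_t (l + 1)
    · cases l with
      | zero => rw [pow_zero, one_mul, rt']; exact poly_mul _ t_mem
      | succ l =>
        rw [pow_succ', mul_assoc, ← mul_assoc, rr']
        exact poly_mul _ (r'_pow_t' l)
  have r'_mul {x : A} (hx : x ∈ S) : r' * x ∈ S := by
    refine mul_mem_wordSpan r'p ?_ hx
    rintro (l | l | l | l) <;> simp only [word]
    · cases l with
      | zero => simpa using r'_pow 1
      | succ l =>
        rw [pow_succ', ← mul_assoc, r'r]
        exact poly_mul _ (r_pow l)
    · simpa [pow_succ'] using r'_pow (l + 2)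
    · cases l with
      | zero => rw [pow_zero, one_mul, r't]; exact poly_mul _ t'_mem
      | succ l =>
        rw [pow_succ', mul_assoc, ← mul_assoc, r'r]
        exact poly_mul _ (r_pow_t l)
    · simpa [pow_succ', mul_assoc] using r'_pow_t' (l + 1)
  have t_r_pow {x : A} (hx : t * x ∈ S) (l : ℕ) : t * (r ^ l * x) ∈ S := by
    induction l with
    | zero => simpa using hx
    | succ l ih =>
      rw [pow_succ', mul_assoc, ← mul_assoc, tr, smul_mul_assoc, mul_assoc]
      exact S.smul_mem _ (r_mul ih)
  have t'_r'_pow {x : A} (hx : t' * x ∈ S) (l : ℕ) : t' * (r' ^ l * x) ∈ S := by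
    induction l with
    | zero => simpa using hx
    | succ l ih =>
      rw [pow_succ', mul_assoc, ← mul_assoc, rel12, smul_mul_assoc, mul_assoc]
      exact S.smul_mem _ (r'_mul ih)
  have t_r'_pow {x : A} (hx : t' * x ∈ S) (l : ℕ) : t * (r' ^ (l + 1) * x) ∈ S := by
    rw [pow_succ', mul_assoc, ← mul_assoc, tr', mul_assoc]
    exact poly_mul _ (t'_r'_pow hx l)
  have t'_r_pow {x : A} (hx : t * x ∈ S) (l : ℕ) : t' * (r ^ (l + 1) * x) ∈ S := by
    rw [pow_succ', mul_assoc, ← mul_assoc, t'r, mul_assoc]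
    exact poly_mul _ (t_r_pow hx l)
  have p_mul {x : A} (hx : x ∈ S) : p * x ∈ S := base_mul_mem_wordSpan hx
  have r_mem : r ∈ S := by simpa using r_pow 1
  have p_mem : p ∈ S := by simpa using p_mul one_mem
  have poly_mem (f : ℂ[X]) : aeval p f ∈ S := by simpa using poly_mul f one_mem
  have sq_t_mem : t * t ∈ S := rel4 ▸ S.smul_mem _ (p_mul r_mem)
  have sq_t'_mem : t' * t' ∈ S := rel14 ▸ S.smul_mem _ (r'_mul p_mem)
  have tt'_mem : t * t' ∈ S := tt' ▸ poly_mem _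
  have t't_mem : t' * t ∈ S := t't ▸ poly_mem _
  have t_mul {x : A} (hx : x ∈ S) : t * x ∈ S := by
    refine mul_mem_wordSpan tp ?_ hx
    rintro (l | l | l | l) <;> simp only [word]
    · simpa using t_r_pow (x := 1) (by simpa using t_mem) l
    · simpa using t_r'_pow (x := 1) (by simpa using t'_mem) l
    · exact t_r_pow sq_t_mem l
    · cases l with
      | zero => simpa using tt'_mem
      | succ l => exact t_r'_pow sq_t'_mem l
  have t'_mul {x : A} (hx : x ∈ S) : t' * x ∈ S := by
    refine mul_mem_wordSpan rel13 ?_ hx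
    rintro (l | l | l | l) <;> simp only [word]
    · cases l with
      | zero => simpa using t'_mem
      | succ l => simpa using t'_r_pow (x := 1) (by simpa using t_mem) l
    · simpa using t'_r'_pow (x := 1) (by simpa using t'_mem) (l + 1)
    · cases l with
      | zero => simpa using t't_mem
      | succ l => exact t'_r_pow sq_t_mem l
    · exact t'_r'_pow sq_t'_mem l
  induction y using FreeAlgebra.induction generalizing x with
  | grade0 a => rw [AlgHom.commutes, ← Algebra.smul_def]; exact S.smul_mem _ hx
  | grade1 i =>
    fin_cases i
    exacts [p_mul hx, r_mul hx, r'_mul hx, t_mul hx, t'_mul hx]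
  | mul a b ha hb => rw [map_mul, mul_assoc]; exact ha (hb hx)
  | add a b ha hb => rw [map_add, add_mul]; exact add_mem (ha hx) (hb hx)

theorem wordSpan_eq_top {q : ℝ} (hq : q ≠ 0) (φ : FreeAlgebra ℂ (Fin 5) →ₐ[ℂ] A)
    (hφ : ∀ ⦃x y⦄, Rel q x y → φ x = φ y) (hsurj : Function.Surjective φ) :
    wordSpan (φ P) (φ R) (φ R') (φ T) (φ T') = ⊤ := by
  refine Submodule.eq_top_iff'.2 fun x => ?_
  obtain ⟨y, rfl⟩ := hsurj x
  have one_mem : (1 : A) ∈ wordSpan (φ P) (φ R) (φ R') (φ T) (φ T') := by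
    simpa [word] using word_mem_wordSpan (p := φ P) (.inl 0)
  simpa using map_mul_mem_wordSpan hq φ hφ y one_mem

end Span

section Representation

/-- The weighted shift of degree `d`, with dilation factor `s` and weight `w`, on functions of an
integer and a complex variable. -/
def shiftOp (d : ℤ) (s : ℂ) (w : ℂ → ℂ) : Module.End ℂ (ℤ → ℂ → ℂ) where
  toFun f n a := w a * f (n - d) (s * a)
  map_add' f g := by ext; simp [mul_add]
  map_smul' c f := by ext; simp [mul_left_comm]

theorem shiftOp_apply (d : ℤ) (s : ℂ) (w : ℂ → ℂ) (f : ℤ → ℂ → ℂ) (n : ℤ) (a : ℂ) :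
    shiftOp d s w f n a = w a * f (n - d) (s * a) := rfl

theorem shiftOp_mul (d d' : ℤ) (s s' : ℂ) (w w' : ℂ → ℂ) :
    shiftOp d s w * shiftOp d' s' w' =
      shiftOp (d + d') (s * s') (fun a => w a * w' (s * a)) := by
  ext f n a
  simp only [Module.End.mul_apply, shiftOp_apply, mul_assoc]
  congr 3
  · ring
  · ring

theorem smul_shiftOp (c : ℂ) (d : ℤ) (s : ℂ) (w : ℂ → ℂ) :
    c • shiftOp d s w = shiftOp d s (fun a => c * w a) := by
  ext f n a
  simp [shiftOp_apply, mul_assoc]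

theorem shiftOp_add (d : ℤ) (s : ℂ) (w w' : ℂ → ℂ) :
    shiftOp d s w + shiftOp d s w' = shiftOp d s (fun a => w a + w' a) := by
  ext f n a
  simp [shiftOp_apply, add_mul]

theorem shiftOp_sub (d : ℤ) (s : ℂ) (w w' : ℂ → ℂ) :
    shiftOp d s w - shiftOp d s w' = shiftOp d s (fun a => w a - w' a) := by
  ext f n a
  simp [shiftOp_apply, sub_mul]

theorem one_eq_shiftOp : (1 : Module.End ℂ (ℤ → ℂ → ℂ)) = shiftOp 0 1 (fun _ => 1) := by
  ext f n a
  simp [shiftOp_apply]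

/-- The images of the five generators under the representation of `O(ℝP²_q)` by weighted
shifts. -/
noncomputable def repGen (q : ℝ) : Fin 5 → Module.End ℂ (ℤ → ℂ → ℂ) :=
  ![shiftOp 0 1 fun a => a ^ 2,
    shiftOp 2 ((q : ℂ) ^ 4) fun _ => 1,
    shiftOp (-2) ((q : ℂ) ^ 4)⁻¹ fun a => (1 - a ^ 2) * (1 - ((q : ℂ) ^ 4)⁻¹ * a ^ 2),
    shiftOp 1 ((q : ℂ) ^ 2) fun a => a,
    shiftOp (-1) ((q : ℂ) ^ 2)⁻¹ fun a => ((q : ℂ) ^ 2)⁻¹ * a * (1 - a ^ 2)]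

/-- The representation of the free algebra by weighted shifts. -/
noncomputable def freeRep (q : ℝ) : FreeAlgebra ℂ (Fin 5) →ₐ[ℂ] Module.End ℂ (ℤ → ℂ → ℂ) :=
  FreeAlgebra.lift ℂ (repGen q)

variable (q : ℝ)

theorem freeRep_P : freeRep q P = shiftOp 0 1 fun a => a ^ 2 := by simp [freeRep, P, repGen]

theorem freeRep_R : freeRep q R = shiftOp 2 ((q : ℂ) ^ 4) fun _ => 1 := by
  simp [freeRep, R, repGen]

theorem freeRep_R' : freeRep q R' =
    shiftOp (-2) ((q : ℂ) ^ 4)⁻¹ fun a => (1 - a ^ 2) * (1 - ((q : ℂ) ^ 4)⁻¹ * a ^ 2) := by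
  simp [freeRep, R', repGen]

theorem freeRep_T : freeRep q T = shiftOp 1 ((q : ℂ) ^ 2) fun a => a := by
  simp [freeRep, T, repGen]

theorem freeRep_T' : freeRep q T' =
    shiftOp (-1) ((q : ℂ) ^ 2)⁻¹ fun a => ((q : ℂ) ^ 2)⁻¹ * a * (1 - a ^ 2) := by
  simp [freeRep, T', repGen]

variable {q}

theorem freeRep_rel (hq : q ≠ 0) ⦃x y : FreeAlgebra ℂ (Fin 5)⦄ (h : Rel q x y) :
    freeRep q x = freeRep q y := by
  have hc : (q : ℂ) ≠ 0 := by exact_mod_cast hq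
  cases h <;>
  · simp only [map_mul, map_smul, map_add, map_sub, map_one, freeRep_P, freeRep_R, freeRep_R',
      freeRep_T, freeRep_T', one_eq_shiftOp, shiftOp_mul, smul_shiftOp]
    norm_num [shiftOp_add, shiftOp_sub, shiftOp_mul, smul_shiftOp, hc]
    congr 1
    all_goals first | (funext a; field_simp; ring) | (funext a; field_simp) | field_simp

/-- The function supported at the integer `n`, where it is the polynomial function of `H`. -/
noncomputable def polySingle (n : ℤ) (H : Polynomial ℂ) : ℤ → ℂ → ℂ :=
  Pi.single n fun a => H.eval a

open Polynomial in
theorem shiftOp_polySingle (d : ℤ) (s : ℂ) {w : ℂ → ℂ} {W : ℂ[X]} (hW : ∀ a, w a = W.eval a)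
    (n : ℤ) (H : ℂ[X]) :
    shiftOp d s w (polySingle n H) = polySingle (d + n) (W * H.comp (C s * X)) := by
  ext m a
  rw [shiftOp_apply, polySingle, polySingle]
  by_cases h : m = d + n
  · subst h
    simp [hW]
  · rw [Pi.single_eq_of_ne h, Pi.single_eq_of_ne (by omega)]
    simp

open Polynomial in
theorem exists_shiftOp_polySingle (d : ℤ) {s : ℂ} (hs : s ≠ 0) {w : ℂ → ℂ} {W : ℂ[X]}
    (hW : ∀ a, w a = W.eval a) (hW0 : W ≠ 0) (n : ℤ) {H : ℂ[X]} (hH : H ≠ 0) :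
    ∃ H' : ℂ[X], H' ≠ 0 ∧ shiftOp d s w (polySingle n H) = polySingle (d + n) H' :=
  ⟨_, mul_ne_zero hW0 ((comp_C_mul_X_eq_zero_iff (mem_nonZeroDivisors_of_ne_zero hs)).not.2 hH),
    shiftOp_polySingle d s hW n H⟩

open Polynomial in
theorem exists_shiftOp_pow_polySingle (d : ℤ) {s : ℂ} (hs : s ≠ 0) {w : ℂ → ℂ} {W : ℂ[X]}
    (hW : ∀ a, w a = W.eval a) (hW0 : W ≠ 0) (n : ℤ) {H : ℂ[X]} (hH : H ≠ 0) (l : ℕ) :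
    ∃ H' : ℂ[X], H' ≠ 0 ∧ (shiftOp d s w ^ l) (polySingle n H) = polySingle (l * d + n) H' := by
  induction l with
  | zero => exact ⟨H, hH, by simp⟩
  | succ l ih =>
    obtain ⟨H₁, h₁, e₁⟩ := ih
    obtain ⟨H₂, h₂, e₂⟩ := exists_shiftOp_polySingle d hs hW hW0 (l * d + n) h₁
    refine ⟨H₂, h₂, ?_⟩
    rw [pow_succ', Module.End.mul_apply, e₁, e₂]
    congr 1
    push_cast
    ring

/-- The degree of a word in the grading with `R, T` of degrees `2, 1` and `R′, T′` of degrees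
`-2, -1`. -/
def wordDeg : ℕ ⊕ (ℕ ⊕ (ℕ ⊕ ℕ)) → ℤ
  | Sum.inl l => 2 * l
  | Sum.inr (Sum.inl l) => -(2 * (l + 1))
  | Sum.inr (Sum.inr (Sum.inl l)) => 2 * l + 1
  | Sum.inr (Sum.inr (Sum.inr l)) => -(2 * l + 1)

theorem wordDeg_injective : Function.Injective wordDeg := by
  rintro (a | a | a | a) (b | b | b | b) h <;> simp only [wordDeg] at h <;>
    first | (exfalso; omega) | ((obtain rfl : a = b := by omega); rfl)

open Polynomial in
theorem exists_freeRep_word (hq : q ≠ 0) (i : ℕ ⊕ (ℕ ⊕ (ℕ ⊕ ℕ))) :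
    ∃ H : ℂ[X], H ≠ 0 ∧ word (freeRep q R) (freeRep q R') (freeRep q T) (freeRep q T') i
      (polySingle 0 1) = polySingle (wordDeg i) H := by
  have hc : (q : ℂ) ≠ 0 := by exact_mod_cast hq
  have ne_zero {W : ℂ[X]} (a : ℂ) (h : W.eval a ≠ 0) : W ≠ 0 := by
    rintro rfl
    simp at h
  have sub_ne_zero (b : ℂ) : (1 - C b * X ^ 2 : ℂ[X]) ≠ 0 := ne_zero 0 (by simp)
  have powR (l : ℕ) (n : ℤ) {H : ℂ[X]} (hH : H ≠ 0) :
      ∃ H' : ℂ[X], H' ≠ 0 ∧ (freeRep q R ^ l) (polySingle n H) = polySingle (l * 2 + n) H' := by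
    rw [freeRep_R]
    exact exists_shiftOp_pow_polySingle 2 (pow_ne_zero _ hc) (W := 1) (by simp) one_ne_zero n hH l
  have powR' (l : ℕ) (n : ℤ) {H : ℂ[X]} (hH : H ≠ 0) :
      ∃ H' : ℂ[X], H' ≠ 0 ∧
        (freeRep q R' ^ l) (polySingle n H) = polySingle (l * (-2) + n) H' := by
    rw [freeRep_R']
    exact exists_shiftOp_pow_polySingle (-2) (inv_ne_zero (pow_ne_zero _ hc))
      (W := (1 - C 1 * X ^ 2) * (1 - C ((q : ℂ) ^ 4)⁻¹ * X ^ 2)) (by simp)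
      (mul_ne_zero (sub_ne_zero _) (sub_ne_zero _)) n hH l
  have actT : ∃ H : ℂ[X], H ≠ 0 ∧ freeRep q T (polySingle 0 1) = polySingle (1 + 0) H := by
    rw [freeRep_T]
    exact exists_shiftOp_polySingle 1 (pow_ne_zero _ hc) (W := X) (by simp) X_ne_zero 0 one_ne_zero
  have actT' : ∃ H : ℂ[X], H ≠ 0 ∧ freeRep q T' (polySingle 0 1) = polySingle (-1 + 0) H := by
    rw [freeRep_T']
    exact exists_shiftOp_polySingle (-1) (inv_ne_zero (pow_ne_zero _ hc))
      (W := C ((q : ℂ) ^ 2)⁻¹ * X * (1 - C 1 * X ^ 2)) (by simp)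
      (mul_ne_zero (mul_ne_zero (C_ne_zero.2 (inv_ne_zero (pow_ne_zero _ hc))) X_ne_zero)
        (sub_ne_zero _)) 0 one_ne_zero
  rcases i with l | l | l | l <;> simp only [word, wordDeg, Module.End.mul_apply]
  · obtain ⟨H, hH, e⟩ := powR l 0 one_ne_zero
    exact ⟨H, hH, by rw [e]; congr 1; ring⟩
  · obtain ⟨H, hH, e⟩ := powR' (l + 1) 0 one_ne_zero
    exact ⟨H, hH, by rw [e]; congr 1; push_cast; ring⟩
  · obtain ⟨H₁, h₁, e₁⟩ := actT
    obtain ⟨H, hH, e⟩ := powR l (1 + 0) h₁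
    exact ⟨H, hH, by rw [e₁, e]; congr 1; ring⟩
  · obtain ⟨H₁, h₁, e₁⟩ := actT'
    obtain ⟨H, hH, e⟩ := powR' l (-1 + 0) h₁
    exact ⟨H, hH, by rw [e₁, e]; congr 1; ring⟩

open Polynomial in
theorem freeRep_P_pow_polySingle (k : ℕ) (n : ℤ) (H : ℂ[X]) :
    (freeRep q P ^ k) (polySingle n H) = polySingle n (X ^ (2 * k) * H) := by
  induction k with
  | zero => simp
  | succ k ih =>
    rw [pow_succ', Module.End.mul_apply, ih, freeRep_P,
      shiftOp_polySingle 0 1 (W := X ^ 2) (by simp), zero_add, C_1, one_mul, comp_X]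
    congr 1
    ring

open Polynomial in
theorem linearIndependent_X_pow_two_mul {H : ℂ[X]} (hH : H ≠ 0) :
    LinearIndependent ℂ fun k : ℕ => X ^ (2 * k) * H := by
  have h : LinearIndependent ℂ fun k : ℕ => (X ^ (2 * k) : ℂ[X]) := by
    have := (basisMonomials ℂ).linearIndependent.comp (fun k : ℕ => 2 * k)
      (mul_right_injective₀ two_ne_zero)
    simpa [Function.comp_def, monomial_one_right_eq_X_pow] using this
  exact h.map' (LinearMap.mulRight ℂ H) (LinearMap.ker_eq_bot.2 (mul_left_injective₀ hH))

/-- The monomials are linearly independent in every algebra through which the representation by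
weighted shifts factors. -/
theorem linearIndependent_pow_mul_word {A : Type*} [Ring A] [Algebra ℂ A] (hq : q ≠ 0)
    (φ : FreeAlgebra ℂ (Fin 5) →ₐ[ℂ] A) (ψ : A →ₐ[ℂ] Module.End ℂ (ℤ → ℂ → ℂ))
    (hψ : ∀ x, ψ (φ x) = freeRep q x) :
    LinearIndependent ℂ fun i : ℕ × (ℕ ⊕ (ℕ ⊕ (ℕ ⊕ ℕ))) =>
      φ P ^ i.1 * word (φ R) (φ R') (φ T) (φ T') i.2 := by
  choose H hH hword using exists_freeRep_word hq
  let ev : (ℕ ⊕ (ℕ ⊕ (ℕ ⊕ ℕ)) →₀ Polynomial ℂ) →ₗ[ℂ] (ℕ ⊕ (ℕ ⊕ (ℕ ⊕ ℕ)) → ℂ → ℂ) :=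
    { toFun := fun f j a => (f j).eval a
      map_add' := fun f g => by ext; simp
      map_smul' := fun c f => by ext; simp }
  have ev_injective : Function.Injective ev := fun f g h =>
    Finsupp.ext fun j => Polynomial.funext fun a => congr_fun (congr_fun h j) a
  have key := (((Finsupp.linearIndependent_single (fun j k => Polynomial.X ^ (2 * k) * H j)
    fun j => linearIndependent_X_pow_two_mul (hH j)).map' ev
      (LinearMap.ker_eq_bot.2 ev_injective)).comp
        (fun i : ℕ × (ℕ ⊕ (ℕ ⊕ (ℕ ⊕ ℕ))) => (⟨i.2, i.1⟩ : Σ _, ℕ))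
        (by rintro ⟨a, b⟩ ⟨a', b'⟩ h; simp_all))
  refine LinearIndependent.of_comp ((LinearMap.funLeft ℂ (ℂ → ℂ) wordDeg).comp
    ((LinearMap.applyₗ (polySingle 0 1)).comp ψ.toLinearMap)) ?_
  convert! key using 1
  ext ⟨k, i⟩ j a
  have hψword : ψ (word (φ R) (φ R') (φ T) (φ T') i) =
      word (freeRep q R) (freeRep q R') (freeRep q T) (freeRep q T') i := by
    rcases i with l | l | l | l <;> simp [word, hψ]
  simp only [Function.comp_apply, LinearMap.comp_apply, LinearMap.funLeft_apply,
    LinearMap.applyₗ_apply_apply, AlgHom.toLinearMap_apply, map_mul, map_pow, hψ, hψword,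
    Module.End.mul_apply, hword, freeRep_P_pow_polySingle]
  change polySingle (wordDeg i) (Polynomial.X ^ (2 * k) * H i) (wordDeg j) a =
    Polynomial.eval a (Finsupp.single i (Polynomial.X ^ (2 * k) * H i) j)
  by_cases h : j = i
  · subst h
    simp [polySingle]
  · rw [polySingle, Pi.single_eq_of_ne (wordDeg_injective.ne h), Finsupp.single_eq_of_ne h]
    simp

end Representation

/-- Separates the power of `P` from the remaining word in the index of a monomial. -/
def splitIndex : (ℕ × ℕ) ⊕ ((ℕ × ℕ) ⊕ ((ℕ × ℕ) ⊕ (ℕ × ℕ))) ≃ ℕ × (ℕ ⊕ (ℕ ⊕ (ℕ ⊕ ℕ))) :=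
  ((Equiv.prodSumDistrib _ _ _).trans <| Equiv.sumCongr (Equiv.refl _) <|
    (Equiv.prodSumDistrib _ _ _).trans <| Equiv.sumCongr (Equiv.refl _) <|
      Equiv.prodSumDistrib _ _ _).symm

end RP2

open RP2 in
/-- The cosets of the monomials `P^k R^l` (`k,l ∈ ℕ`), `P^k (R′)^l`
(`k ∈ ℕ`, `l ≥ 1`), `P^k R^l T` (`k,l ∈ ℕ`) and `P^k (R′)^l T′` (`k,l ∈ ℕ`) form a basis of
the coordinate algebra `O(ℝP²_q)` of the quantum real projective plane as a `ℂ`-vector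
space. -/
theorem stmt15 (q : ℝ) (hq0 : 0 < q) (hq1 : q < 1) :
    LinearIndependent ℂ
      (fun i : (ℕ × ℕ) ⊕ ((ℕ × ℕ) ⊕ ((ℕ × ℕ) ⊕ (ℕ × ℕ))) =>
        match i with
        | Sum.inl (k, l) =>
            RingQuot.mkAlgHom ℂ (RP2.Rel q) P ^ k * RingQuot.mkAlgHom ℂ (RP2.Rel q) R ^ l
        | Sum.inr (Sum.inl (k, l)) =>
            RingQuot.mkAlgHom ℂ (RP2.Rel q) P ^ k *
              RingQuot.mkAlgHom ℂ (RP2.Rel q) R' ^ (l + 1)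
        | Sum.inr (Sum.inr (Sum.inl (k, l))) =>
            RingQuot.mkAlgHom ℂ (RP2.Rel q) P ^ k * RingQuot.mkAlgHom ℂ (RP2.Rel q) R ^ l *
              RingQuot.mkAlgHom ℂ (RP2.Rel q) T
        | Sum.inr (Sum.inr (Sum.inr (k, l))) =>
            RingQuot.mkAlgHom ℂ (RP2.Rel q) P ^ k * RingQuot.mkAlgHom ℂ (RP2.Rel q) R' ^ l *
              RingQuot.mkAlgHom ℂ (RP2.Rel q) T') ∧
    Submodule.span ℂ
      (Set.range (fun i : (ℕ × ℕ) ⊕ ((ℕ × ℕ) ⊕ ((ℕ × ℕ) ⊕ (ℕ × ℕ))) =>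
        match i with
        | Sum.inl (k, l) =>
            RingQuot.mkAlgHom ℂ (RP2.Rel q) P ^ k * RingQuot.mkAlgHom ℂ (RP2.Rel q) R ^ l
        | Sum.inr (Sum.inl (k, l)) =>
            RingQuot.mkAlgHom ℂ (RP2.Rel q) P ^ k *
              RingQuot.mkAlgHom ℂ (RP2.Rel q) R' ^ (l + 1)
        | Sum.inr (Sum.inr (Sum.inl (k, l))) =>
            RingQuot.mkAlgHom ℂ (RP2.Rel q) P ^ k * RingQuot.mkAlgHom ℂ (RP2.Rel q) R ^ l *
              RingQuot.mkAlgHom ℂ (RP2.Rel q) T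
        | Sum.inr (Sum.inr (Sum.inr (k, l))) =>
            RingQuot.mkAlgHom ℂ (RP2.Rel q) P ^ k * RingQuot.mkAlgHom ℂ (RP2.Rel q) R' ^ l *
              RingQuot.mkAlgHom ℂ (RP2.Rel q) T')) = ⊤ := by
  have hq : q ≠ 0 := hq0.ne'
  set φ := RingQuot.mkAlgHom ℂ (RP2.Rel q)
  have hfam : (fun i : (ℕ × ℕ) ⊕ ((ℕ × ℕ) ⊕ ((ℕ × ℕ) ⊕ (ℕ × ℕ))) =>
        match i with
        | Sum.inl (k, l) => φ P ^ k * φ R ^ l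
        | Sum.inr (Sum.inl (k, l)) => φ P ^ k * φ R' ^ (l + 1)
        | Sum.inr (Sum.inr (Sum.inl (k, l))) => φ P ^ k * φ R ^ l * φ T
        | Sum.inr (Sum.inr (Sum.inr (k, l))) => φ P ^ k * φ R' ^ l * φ T') =
      (fun i : ℕ × (ℕ ⊕ (ℕ ⊕ (ℕ ⊕ ℕ))) =>
        φ P ^ i.1 * word (φ R) (φ R') (φ T) (φ T') i.2) ∘ splitIndex := by
    funext i
    rcases i with ⟨k, l⟩ | ⟨k, l⟩ | ⟨k, l⟩ | ⟨k, l⟩ <;> simp [splitIndex, word, mul_assoc]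
  rw [hfam]
  refine ⟨(linearIndependent_pow_mul_word hq φ
    (RingQuot.liftAlgHom ℂ ⟨freeRep q, freeRep_rel hq⟩)
    (RingQuot.liftAlgHom_mkAlgHom_apply ℂ _ _)).comp _ splitIndex.injective, ?_⟩
  rw [splitIndex.surjective.range_comp]
  exact wordSpan_eq_top hq φ (fun _ _ h => RingQuot.mkAlgHom_rel ℂ h)
    (RingQuot.mkAlgHom_surjective ℂ _)
end

section
/- Let q be a real number with 0 < q < 1 and let O(S²_{q,1}) be the quotient of the free unital ℂ-algebra on generators K, L, L′ by the two-sided ideal generated by LK − q²KL, KL′ − q²L′K, L′L + K² − 1, LL′ + q⁴K² − 1. Then the assignment K ↦ −K, L ↦ L, L′ ↦ L′ extends to a well-defined ℂ-algebra automorphism r₁ of O(S²_{q,1}) with r₁ ∘ r₁ = id, the fixed-point subalgebra {a ∈ O(S²_{q,1}) : r₁(a) = a} equals the unital subalgebra generated by L and L′, and this fixed-point subalgebra is isomorphic, via x ↦ L′ and x′ ↦ L, to the quantum disc algebra O(D_{q⁴}), i.e. the quotient of the free unital ℂ-algebra on generators x, x′ by the two-sided ideal generated by x′x − q⁴xx′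 − (1 − q⁴). -/
namespace PodlesSphere

/-- Generator `K` of `O(S²_{q,1})` in the free algebra on three generators. -/
noncomputable def K : FreeAlgebra ℂ (Fin 3) := FreeAlgebra.ι ℂ 0
/-- Generator `L` of `O(S²_{q,1})`. -/
noncomputable def L : FreeAlgebra ℂ (Fin 3) := FreeAlgebra.ι ℂ 1
/-- Generator `L′ = L*` of `O(S²_{q,1})`. -/
noncomputable def L' : FreeAlgebra ℂ (Fin 3) := FreeAlgebra.ι ℂ 2

/-- The defining relations of the coordinate algebra `O(S²_{q,1})` of the equator Podleś
quantum sphere, on generators `K, L, L′` (with `L′` playing the role of `L*`):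
`LK = q²KL`, `KL′ = q²L′K`, `L′L + K² = 1`, `LL′ + q⁴K² = 1`. -/
inductive Rel (q : ℝ) : FreeAlgebra ℂ (Fin 3) → FreeAlgebra ℂ (Fin 3) → Prop
  | rel1 : Rel q (L * K) (((q : ℂ) ^ 2) • (K * L))
  | rel2 : Rel q (K * L') (((q : ℂ) ^ 2) • (L' * K))
  | rel3 : Rel q (L' * L + K * K) 1
  | rel4 : Rel q (L * L' + ((q : ℂ) ^ 4) • (K * K)) 1

end PodlesSphere

/-- The defining relation of the Klimek–Lesniewski quantum disc algebra `O(D_{q⁴})`, on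
generators `0 ↦ x`, `1 ↦ x′` (with `x′` playing the role of `x*`):
`x′x = q⁴ xx′ + (1 - q⁴)`. -/
inductive DiscRel (q : ℝ) : FreeAlgebra ℂ (Fin 2) → FreeAlgebra ℂ (Fin 2) → Prop
  | rel : DiscRel q (FreeAlgebra.ι ℂ 1 * FreeAlgebra.ι ℂ 0)
      (((q : ℂ) ^ 4) • (FreeAlgebra.ι ℂ 0 * FreeAlgebra.ι ℂ 1) +
        ((1 : ℂ) - (q : ℂ) ^ 4) • (1 : FreeAlgebra ℂ (Fin 2)))

namespace PodlesSphere

/-- The image of `K` in `O(S²_{q,1})`. -/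
noncomputable abbrev mkK (q : ℝ) : RingQuot (Rel q) := RingQuot.mkAlgHom ℂ (Rel q) K
/-- The image of `L` in `O(S²_{q,1})`. -/
noncomputable abbrev mkL (q : ℝ) : RingQuot (Rel q) := RingQuot.mkAlgHom ℂ (Rel q) L
/-- The image of `L′` in `O(S²_{q,1})`. -/
noncomputable abbrev mkL' (q : ℝ) : RingQuot (Rel q) := RingQuot.mkAlgHom ℂ (Rel q) L'

/-- The subalgebra of `O(S²_{q,1})` generated by `L` and `L′`. -/
noncomputable abbrev evenPart (q : ℝ) : Subalgebra ℂ (RingQuot (Rel q)) :=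
  Algebra.adjoin ℂ {mkL q, mkL' q}

theorem mkL_mul_mkK (q : ℝ) : mkL q * mkK q = ((q : ℂ) ^ 2) • (mkK q * mkL q) := by
  simpa using RingQuot.mkAlgHom_rel ℂ (Rel.rel1 (q := q))

theorem mkK_mul_mkL' (q : ℝ) : mkK q * mkL' q = ((q : ℂ) ^ 2) • (mkL' q * mkK q) := by
  simpa using RingQuot.mkAlgHom_rel ℂ (Rel.rel2 (q := q))

theorem mkL'_mul_mkL (q : ℝ) : mkL' q * mkL q + mkK q * mkK q = 1 := by
  simpa using RingQuot.mkAlgHom_rel ℂ (Rel.rel3 (q := q))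

theorem mkL_mul_mkL' (q : ℝ) :
    mkL q * mkL' q + ((q : ℂ) ^ 4) • (mkK q * mkK q) = 1 := by
  simpa using RingQuot.mkAlgHom_rel ℂ (Rel.rel4 (q := q))

section Lift

variable {A : Type*} [Ring A] [Algebra ℂ A]

theorem mul_neg_eq_smul {c : ℂ} {k l : A} (h : l * k = c • (k * l)) :
    l * -k = c • (-k * l) := by
  simp [h]

theorem neg_mul_eq_smul {c : ℂ} {k l : A} (h : k * l = c • (l * k)) :
    -k * l = c • (l * -k) := by
  simp [h]

/-- The universal property of `O(S²_{q,1})`. -/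
noncomputable def lift (q : ℝ) (k l l' : A) (h₁ : l * k = ((q : ℂ) ^ 2) • (k * l))
    (h₂ : k * l' = ((q : ℂ) ^ 2) • (l' * k)) (h₃ : l' * l + k * k = 1)
    (h₄ : l * l' + ((q : ℂ) ^ 4) • (k * k) = 1) : RingQuot (Rel q) →ₐ[ℂ] A :=
  RingQuot.liftAlgHom ℂ ⟨FreeAlgebra.lift ℂ ![k, l, l'], by
    rintro _ _ (_ | _ | _ | _) <;> simpa [K, L, L']⟩

variable {q : ℝ} {k l l' : A} (h₁ : l * k = ((q : ℂ) ^ 2) • (k * l))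
  (h₂ : k * l' = ((q : ℂ) ^ 2) • (l' * k)) (h₃ : l' * l + k * k = 1)
  (h₄ : l * l' + ((q : ℂ) ^ 4) • (k * k) = 1)

@[simp]
theorem lift_mkK : lift q k l l' h₁ h₂ h₃ h₄ (mkK q) = k := by
  simp [lift, K]

@[simp]
theorem lift_mkL : lift q k l l' h₁ h₂ h₃ h₄ (mkL q) = l := by
  simp [lift, L]

@[simp]
theorem lift_mkL' : lift q k l l' h₁ h₂ h₃ h₄ (mkL' q) = l' := by
  simp [lift, L']

theorem algHom_ext {f g : RingQuot (Rel q) →ₐ[ℂ] A} (hK : f (mkK q) = g (mkK q))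
    (hL : f (mkL q) = g (mkL q)) (hL' : f (mkL' q) = g (mkL' q)) : f = g := by
  apply RingQuot.ringQuot_ext'
  apply FreeAlgebra.hom_ext
  funext i
  fin_cases i
  · exact hK
  · exact hL
  · exact hL'

end Lift

/-- The endomorphism of `O(S²_{q,1})` with `K ↦ -K`, `L ↦ L`, `L′ ↦ L′`. -/
noncomputable def reflHom (q : ℝ) : RingQuot (Rel q) →ₐ[ℂ] RingQuot (Rel q) :=
  lift q (-mkK q) (mkL q) (mkL' q) (mul_neg_eq_smul (mkL_mul_mkK q))
    (neg_mul_eq_smul (mkK_mul_mkL' q)) (by rw [neg_mul_neg (mkK q) (mkK q), mkL'_mul_mkL])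
    (by rw [neg_mul_neg (mkK q) (mkK q), mkL_mul_mkL'])

theorem reflHom_mkK (q : ℝ) : reflHom q (mkK q) = -mkK q := lift_mkK _ _ _ _

theorem reflHom_mkL (q : ℝ) : reflHom q (mkL q) = mkL q := lift_mkL _ _ _ _

theorem reflHom_mkL' (q : ℝ) : reflHom q (mkL' q) = mkL' q := lift_mkL' _ _ _ _

theorem reflHom_comp_reflHom (q : ℝ) :
    (reflHom q).comp (reflHom q) = AlgHom.id ℂ (RingQuot (Rel q)) := by
  apply algHom_ext <;>
    simp only [AlgHom.comp_apply, AlgHom.id_apply, reflHom_mkK, reflHom_mkL, reflHom_mkL', map_neg,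
      neg_neg]

/-- The reflection of `O(S²_{q,1})` identifying the two hemispheres. -/
noncomputable def reflEquiv (q : ℝ) : RingQuot (Rel q) ≃ₐ[ℂ] RingQuot (Rel q) :=
  AlgEquiv.ofAlgHom (reflHom q) (reflHom q) (reflHom_comp_reflHom q) (reflHom_comp_reflHom q)

theorem mkL_mem (q : ℝ) : mkL q ∈ evenPart q := Algebra.subset_adjoin (by simp)

theorem mkL'_mem (q : ℝ) : mkL' q ∈ evenPart q := Algebra.subset_adjoin (by simp)

theorem mkK_mul_mkK_mem (q : ℝ) : mkK q * mkK q ∈ evenPart q := by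
  rw [eq_sub_of_add_eq' (mkL'_mul_mkL q)]
  exact sub_mem (one_mem _) (mul_mem (mkL'_mem q) (mkL_mem q))

theorem reflHom_eq_self_of_mem {q : ℝ} {a : RingQuot (Rel q)} (ha : a ∈ evenPart q) :
    reflHom q a = a := by
  have h : evenPart q ≤ AlgHom.equalizer (reflHom q) (AlgHom.id ℂ _) := by
    rw [Algebra.adjoin_le_iff]
    rintro _ (rfl | rfl)
    · exact reflHom_mkL q
    · exact reflHom_mkL' q
  exact h ha

theorem exists_mkK_mul_eq {q : ℝ} (hq : q ≠ 0) {a : RingQuot (Rel q)} (ha : a ∈ evenPart q) :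
    ∃ b ∈ evenPart q, mkK q * a = b * mkK q := by
  induction ha using Algebra.adjoin_induction with
  | mem x hx =>
    rcases hx with rfl | rfl
    · refine ⟨((q : ℂ) ^ 2)⁻¹ • mkL q, Subalgebra.smul_mem _ (mkL_mem q) _, ?_⟩
      rw [smul_mul_assoc, mkL_mul_mkK, inv_smul_smul₀ (by simpa using hq)]
    · refine ⟨((q : ℂ) ^ 2) • mkL' q, Subalgebra.smul_mem _ (mkL'_mem q) _, ?_⟩
      rw [smul_mul_assoc, mkK_mul_mkL']
  | algebraMap r => exact ⟨_, algebraMap_mem _ r, (Algebra.commutes _ _).symm⟩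
  | add x y _ _ hx hy =>
    obtain ⟨b, hb, hx⟩ := hx
    obtain ⟨c, hc, hy⟩ := hy
    exact ⟨b + c, add_mem hb hc, by rw [mul_add, add_mul, hx, hy]⟩
  | mul x y _ _ hx hy =>
    obtain ⟨b, hb, hx⟩ := hx
    obtain ⟨c, hc, hy⟩ := hy
    exact ⟨b * c, mul_mem hb hc, by rw [← mul_assoc, hx, mul_assoc, hy, mul_assoc]⟩

theorem adjoin_eq_top (q : ℝ) :
    Algebra.adjoin ℂ {mkK q, mkL q, mkL' q} = (⊤ : Subalgebra ℂ (RingQuot (Rel q))) := by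
  have h := congrArg (Subalgebra.map (RingQuot.mkAlgHom ℂ (Rel q)))
    (FreeAlgebra.adjoin_range_ι (R := ℂ) (X := Fin 3))
  rw [AlgHom.map_adjoin, Algebra.map_top,
    (AlgHom.range_eq_top _).2 (RingQuot.mkAlgHom_surjective ℂ (Rel q))] at h
  rw [← h, ← Set.range_comp]
  congr 1
  ext a
  simp [Fin.exists_fin_succ, eq_comm]
  rfl

theorem exists_eq_add_mul_mkK {q : ℝ} (hq : q ≠ 0) (a : RingQuot (Rel q)) :
    ∃ b ∈ evenPart q, ∃ c ∈ evenPart q, a = b + c * mkK q := by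
  have ha : a ∈ Algebra.adjoin ℂ {mkK q, mkL q, mkL' q} := by
    rw [adjoin_eq_top]; trivial
  induction ha using Algebra.adjoin_induction with
  | mem x hx =>
    rcases hx with rfl | rfl | rfl
    · exact ⟨0, zero_mem _, 1, one_mem _, by simp⟩
    · exact ⟨_, mkL_mem q, 0, zero_mem _, by simp⟩
    · exact ⟨_, mkL'_mem q, 0, zero_mem _, by simp⟩
  | algebraMap r => exact ⟨_, algebraMap_mem _ r, 0, zero_mem _, by simp⟩
  | add x y _ _ hx hy =>
    obtain ⟨b, hb, c, hc, rfl⟩ := hx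
    obtain ⟨b', hb', c', hc', rfl⟩ := hy
    exact ⟨b + b', add_mem hb hb', c + c', add_mem hc hc', by noncomm_ring⟩
  | mul x y _ _ hx hy =>
    obtain ⟨b, hb, c, hc, rfl⟩ := hx
    obtain ⟨b', hb', c', hc', rfl⟩ := hy
    obtain ⟨d, hd, hbd⟩ := exists_mkK_mul_eq hq hb'
    obtain ⟨e, he, hce⟩ := exists_mkK_mul_eq hq hc'
    refine ⟨b * b' + c * e * (mkK q * mkK q),
      add_mem (mul_mem hb hb') (mul_mem (mul_mem hc he) (mkK_mul_mkK_mem q)),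
      b * c' + c * d, add_mem (mul_mem hb hc') (mul_mem hc hd), ?_⟩
    calc (b + c * mkK q) * (b' + c' * mkK q)
        = b * b' + b * c' * mkK q + c * (mkK q * b') + c * (mkK q * c') * mkK q := by
          noncomm_ring
      _ = _ := by rw [hbd, hce]; noncomm_ring

theorem reflHom_eq_self_iff {q : ℝ} (hq : q ≠ 0) {a : RingQuot (Rel q)} :
    reflHom q a = a ↔ a ∈ evenPart q := by
  refine ⟨fun h ↦ ?_, reflHom_eq_self_of_mem⟩
  obtain ⟨b, hb, c, hc, rfl⟩ := exists_eq_add_mul_mkK hq a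
  rw [map_add, map_mul, reflHom_mkK, reflHom_eq_self_of_mem hb, reflHom_eq_self_of_mem hc,
    mul_neg c (mkK q), add_right_inj] at h
  have h2 : (2 : ℂ) • (c * mkK q) = 0 := by
    rw [two_smul]
    nth_rewrite 1 [← h]
    exact neg_add_cancel _
  rw [(smul_eq_zero_iff_right (two_ne_zero' ℂ)).1 h2, add_zero]
  exact hb

end PodlesSphere

namespace QuantumDisc

/-- The image of `x` in the quantum disc algebra. -/
noncomputable abbrev mkX (q : ℝ) : RingQuot (DiscRel q) :=
  RingQuot.mkAlgHom ℂ (DiscRel q) (FreeAlgebra.ι ℂ 0)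
/-- The image of `x′` in the quantum disc algebra. -/
noncomputable abbrev mkX' (q : ℝ) : RingQuot (DiscRel q) :=
  RingQuot.mkAlgHom ℂ (DiscRel q) (FreeAlgebra.ι ℂ 1)

theorem mkX'_mul_mkX (q : ℝ) : mkX' q * mkX q =
    ((q : ℂ) ^ 4) • (mkX q * mkX' q) + ((1 : ℂ) - (q : ℂ) ^ 4) • 1 := by
  simpa only [map_mul, map_add, map_smul, map_one] using
    RingQuot.mkAlgHom_rel ℂ (DiscRel.rel (q := q))

section Lift

variable {A : Type*} [Ring A] [Algebra ℂ A]

/-- The universal property of the quantum disc algebra. -/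
noncomputable def lift (q : ℝ) (x x' : A)
    (h : x' * x = ((q : ℂ) ^ 4) • (x * x') + ((1 : ℂ) - (q : ℂ) ^ 4) • (1 : A)) :
    RingQuot (DiscRel q) →ₐ[ℂ] A :=
  RingQuot.liftAlgHom ℂ ⟨FreeAlgebra.lift ℂ ![x, x'], by
    rintro _ _ ⟨⟩
    simpa only [map_mul, map_add, map_smul, map_one, FreeAlgebra.lift_ι_apply,
      Matrix.cons_val_zero, Matrix.cons_val_one] using h⟩

variable {q : ℝ} {x x' : A}
  (h : x' * x = ((q : ℂ) ^ 4) • (x * x') + ((1 : ℂ) - (q : ℂ) ^ 4) • (1 : A))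

@[simp]
theorem lift_mkX : lift q x x' h (mkX q) = x := by simp [lift]

@[simp]
theorem lift_mkX' : lift q x x' h (mkX' q) = x' := by simp [lift]

theorem algHom_ext {f g : RingQuot (DiscRel q) →ₐ[ℂ] A} (hx : f (mkX q) = g (mkX q))
    (hx' : f (mkX' q) = g (mkX' q)) : f = g := by
  apply RingQuot.ringQuot_ext'
  apply FreeAlgebra.hom_ext
  funext i
  fin_cases i
  · exact hx
  · exact hx'

end Lift

theorem adjoin_eq_top (q : ℝ) :
    Algebra.adjoin ℂ {mkX q, mkX' q} = (⊤ : Subalgebra ℂ (RingQuot (DiscRel q))) := by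
  have h := congrArg (Subalgebra.map (RingQuot.mkAlgHom ℂ (DiscRel q)))
    (FreeAlgebra.adjoin_range_ι (R := ℂ) (X := Fin 2))
  rw [AlgHom.map_adjoin, Algebra.map_top,
    (AlgHom.range_eq_top _).2 (RingQuot.mkAlgHom_surjective ℂ (DiscRel q))] at h
  rw [← h, ← Set.range_comp]
  congr 1
  ext a
  simp [Fin.exists_fin_succ, eq_comm]

/-- The automorphism `x ↦ q⁻²x`, `x′ ↦ q²x′` of the quantum disc algebra, as a homomorphism. -/
noncomputable def twist {q : ℝ} (hq : q ≠ 0) : RingQuot (DiscRel q) →ₐ[ℂ] RingQuot (DiscRel q) :=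
  lift q (((q : ℂ) ^ 2)⁻¹ • mkX q) (((q : ℂ) ^ 2) • mkX' q) (by
    have h : ((q : ℂ) ^ 2) ≠ 0 := by simpa using hq
    rw [smul_mul_smul_comm, smul_mul_smul_comm, mul_inv_cancel₀ h, inv_mul_cancel₀ h, one_smul,
      one_smul, mkX'_mul_mkX])

/-- The homomorphism from the quantum disc algebra to `O(S²_{q,1})` with `x ↦ L′`, `x′ ↦ L`. -/
noncomputable def toSphere (q : ℝ) : RingQuot (DiscRel q) →ₐ[ℂ] RingQuot (PodlesSphere.Rel q) :=
  lift q (PodlesSphere.mkL' q) (PodlesSphere.mkL q) (by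
    rw [eq_sub_of_add_eq (PodlesSphere.mkL_mul_mkL' q),
      eq_sub_of_add_eq (PodlesSphere.mkL'_mul_mkL q)]
    module)

theorem one_sub_mul_mkX (q : ℝ) : (1 - mkX q * mkX' q) * mkX q =
    ((q : ℂ) ^ 4) • (mkX q * (1 - mkX q * mkX' q)) := by
  rw [sub_mul, mul_assoc, mkX'_mul_mkX, mul_sub, mul_add, mul_smul_comm, mul_smul_comm,
    one_mul, mul_one]
  module

theorem mkX'_mul_one_sub (q : ℝ) : mkX' q * (1 - mkX q * mkX' q) =
    ((q : ℂ) ^ 4) • ((1 - mkX q * mkX' q) * mkX' q) := by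
  rw [mul_sub, ← mul_assoc, mkX'_mul_mkX, sub_mul, add_mul, smul_mul_assoc, smul_mul_assoc,
    one_mul, mul_one]
  module

/-- The action of `O(S²_{q,1})` on itself by left multiplication, written in the basis `1, K` over
the quantum disc algebra. -/
noncomputable def sphereToMatrix {q : ℝ} (hq : q ≠ 0) :
    RingQuot (PodlesSphere.Rel q) →ₐ[ℂ] Matrix (Fin 2) (Fin 2) (RingQuot (DiscRel q)) :=
  PodlesSphere.lift q !![0, 1 - mkX q * mkX' q; 1, 0]
    !![mkX' q, 0; 0, ((q : ℂ) ^ 2) • mkX' q] !![mkX q, 0; 0, ((q : ℂ) ^ 2)⁻¹ • mkX q]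
    (by
      have h : mkX' q * (1 - mkX q * mkX' q) =
          ((q : ℂ) ^ 2) • ((1 - mkX q * mkX' q) * (((q : ℂ) ^ 2) • mkX' q)) := by
        rw [mkX'_mul_one_sub, mul_smul_comm, smul_smul]
        ring_nf
      ext i j
      fin_cases i <;> fin_cases j <;> simp [Matrix.mul_apply, -map_mul, h])
    (by
      have hq' : (q : ℂ) ^ 2 ≠ 0 := by simpa using hq
      have h : (1 - mkX q * mkX' q) * (((q : ℂ) ^ 2)⁻¹ • mkX q) =
          ((q : ℂ) ^ 2) • (mkX q * (1 - mkX q * mkX' q)) := by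
        rw [mul_smul_comm, one_sub_mul_mkX, smul_smul]
        congr 1
        field_simp
      have h' : mkX q = ((q : ℂ) ^ 2) • (((q : ℂ) ^ 2)⁻¹ • mkX q) := by
        rw [smul_inv_smul₀ hq']
      ext i j
      fin_cases i <;> fin_cases j
      · simp
      · simpa using h
      · simpa using h'
      · simp)
    (by
      have hq' : (q : ℂ) ^ 2 ≠ 0 := by simpa using hq
      have h : (((q : ℂ) ^ 2)⁻¹ • mkX q) * (((q : ℂ) ^ 2) • mkX' q) = mkX q * mkX' q := by
        rw [smul_mul_smul_comm, inv_mul_cancel₀ hq', one_smul]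
      rw [Matrix.mul_fin_two, Matrix.mul_fin_two, h, Matrix.one_fin_two]
      simp)
    (by
      have hq' : (q : ℂ) ^ 2 ≠ 0 := by simpa using hq
      have h : (((q : ℂ) ^ 2) • mkX' q) * (((q : ℂ) ^ 2)⁻¹ • mkX q) = mkX' q * mkX q := by
        rw [smul_mul_smul_comm, mul_inv_cancel₀ hq', one_smul]
      have h' : mkX' q * mkX q + ((q : ℂ) ^ 4) • (1 - mkX q * mkX' q) = 1 := by
        rw [mkX'_mul_mkX]
        module
      rw [Matrix.mul_fin_two, Matrix.mul_fin_two, h, Matrix.one_fin_two]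
      simpa using h')

theorem sphereToMatrix_comp_toSphere {q : ℝ} (hq : q ≠ 0) :
    (sphereToMatrix hq).comp (toSphere q) =
      (Matrix.diagonalAlgHom ℂ).comp
        (AlgHom.pi (R := ℂ) (A := fun _ : Fin 2 ↦ RingQuot (DiscRel q)) ![AlgHom.id ℂ _, twist hq]) := by
  apply algHom_ext
  all_goals
    simp only [AlgHom.comp_apply, toSphere, sphereToMatrix, lift_mkX, lift_mkX',
      PodlesSphere.lift_mkL, PodlesSphere.lift_mkL']
    ext i j
    fin_cases i <;> fin_cases j <;> simp [twist]

theorem toSphere_injective {q : ℝ} (hq : q ≠ 0) : Function.Injective (toSphere q) := by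
  intro a b hab
  have h := congrArg (fun c ↦ sphereToMatrix hq c 0 0) hab
  simp only [← AlgHom.comp_apply, sphereToMatrix_comp_toSphere] at h
  simpa using h

theorem range_toSphere (q : ℝ) : (toSphere q).range = PodlesSphere.evenPart q := by
  rw [← Algebra.map_top, ← adjoin_eq_top, AlgHom.map_adjoin, Set.image_pair, toSphere, lift_mkX,
    lift_mkX', Set.pair_comm]

/-- The quantum disc algebra is isomorphic to the subalgebra of `O(S²_{q,1})` generated by `L`
and `L′`. -/
noncomputable def equivEvenPart {q : ℝ} (hq : q ≠ 0) :
    RingQuot (DiscRel q) ≃ₐ[ℂ] PodlesSphere.evenPart q :=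
  (AlgEquiv.ofInjective (toSphere q) (toSphere_injective hq)).trans
    (Subalgebra.equivOfEq _ _ (range_toSphere q))

end QuantumDisc

open PodlesSphere in
/-- The assignment `K ↦ -K`, `L ↦ L`, `L′ ↦ L′` extends to a well-defined
`ℂ`-algebra automorphism `r₁` of `O(S²_{q,1})` squaring to the identity, whose fixed-point
subalgebra is the unital subalgebra generated by `L` and `L′`, and this fixed-point
subalgebra is isomorphic to the quantum disc algebra `O(D_{q⁴})` via `x ↦ L′`, `x′ ↦ L`. -/
theorem stmt17 (q : ℝ) (hq0 : 0 < q) (hq1 : q < 1) :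
    ∃ r₁ : RingQuot (PodlesSphere.Rel q) ≃ₐ[ℂ] RingQuot (PodlesSphere.Rel q),
      r₁ (RingQuot.mkAlgHom ℂ (PodlesSphere.Rel q) K) =
        -(RingQuot.mkAlgHom ℂ (PodlesSphere.Rel q) K) ∧
      r₁ (RingQuot.mkAlgHom ℂ (PodlesSphere.Rel q) L) =
        RingQuot.mkAlgHom ℂ (PodlesSphere.Rel q) L ∧
      r₁ (RingQuot.mkAlgHom ℂ (PodlesSphere.Rel q) L') =
        RingQuot.mkAlgHom ℂ (PodlesSphere.Rel q) L' ∧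
      (∀ a, r₁ (r₁ a) = a) ∧
      {a | r₁ a = a} =
        (Algebra.adjoin ℂ
          ({RingQuot.mkAlgHom ℂ (PodlesSphere.Rel q) L,
            RingQuot.mkAlgHom ℂ (PodlesSphere.Rel q) L'} :
            Set (RingQuot (PodlesSphere.Rel q))) : Set (RingQuot (PodlesSphere.Rel q))) ∧
      ∃ iso : RingQuot (DiscRel q) ≃ₐ[ℂ]
          (Algebra.adjoin ℂ
            ({RingQuot.mkAlgHom ℂ (PodlesSphere.Rel q) L,
              RingQuot.mkAlgHom ℂ (PodlesSphere.Rel q) L'} :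
              Set (RingQuot (PodlesSphere.Rel q)))),
        (iso (RingQuot.mkAlgHom ℂ (DiscRel q) (FreeAlgebra.ι ℂ 0)) :
            RingQuot (PodlesSphere.Rel q)) =
          RingQuot.mkAlgHom ℂ (PodlesSphere.Rel q) L' ∧
        (iso (RingQuot.mkAlgHom ℂ (DiscRel q) (FreeAlgebra.ι ℂ 1)) :
            RingQuot (PodlesSphere.Rel q)) =
          RingQuot.mkAlgHom ℂ (PodlesSphere.Rel q) L := by
  exact ⟨reflEquiv q, reflHom_mkK q, reflHom_mkL q, reflHom_mkL' q,
    fun a ↦ DFunLike.congr_fun (reflHom_comp_reflHom q) a,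
    Set.ext fun _ ↦ reflHom_eq_self_iff hq0.ne',
    QuantumDisc.equivEvenPart hq0.ne', QuantumDisc.lift_mkX _, QuantumDisc.lift_mkX' _⟩
end
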